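/- For every Λ ≥ 1 there is a constant c(d,Λ) such that the following holds whenever C₀ ≥ c(d,Λ) and A₀ = C₀^Λ. Let μ be a compactly supported Radon measure on ℝ^d and let D_μ be a David–Mattila lattice for μ with parameters C₀, A₀ and with D_{μ,0} = {supp μ}. If Q ∈ D_{μ,k} with k ≥ 3 is P-doubling, then μ(100B(Q)) ≤ C₀ μ(B(Q)); moreover, every cube R ∈ D_μ with R ∩ 2Q ≠ ∅ and ℓ(R) = A₀·ℓ(Q) satisfies μ(100B(R)) ≤ C₀ μ(B(R)). -/

import Mathlib

open MeasureTheory Metric Set Filter Topology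
open scoped ENNReal NNReal Classical

noncomputable section

/-- `ℝ^d` as a Euclidean space. -/
abbrev Euc (d : ℕ) : Type := EuclideanSpace ℝ (Fin d)

/-- The support of a measure: the set of points all whose balls have positive measure. -/
def measSupport {d : ℕ} (μ : Measure (Euc d)) : Set (Euc d) :=
  {x | ∀ r : ℝ, 0 < r → 0 < μ (ball x r)}

/-- Side length of the generation-`k` cubes: `ℓ = 56 C₀ A₀^{-k}`. -/
def sideLen (C₀ A₀ : ℝ) (k : ℕ) : ℝ := 56 * C₀ * A₀ ^ (-(k : ℤ))

/-- The density `θ_μ(B(c,r)) = μ(B(c,r))/rⁿ`. -/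
def thetaB {d : ℕ} (n : ℕ) (μ : Measure (Euc d)) (c : Euc d) (r : ℝ) : ℝ≥0∞ :=
  μ (ball c r) / ENNReal.ofReal (r ^ n)

/-- A David–Mattila lattice for a compactly supported Radon measure `μ` on `ℝ^d`, with parameters
`C₀ > 1` and `A₀ > 5000 C₀`: a sequence of partitions `cubes k` of `supp μ` into Borel "cubes",
each carrying a ball `B(Q) = B(center Q, radius Q)`, with the nesting, comparability, disjointness,
small-boundary and non-doubling properties of [David–Mattila]. -/
structure DMLattice (d : ℕ) (μ : Measure (Euc d)) (C₀ A₀ : ℝ) where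
  hC₀ : 1 < C₀
  hA₀ : 5000 * C₀ < A₀
  cubes : ℕ → Set (Set (Euc d))
  center : ℕ → Set (Euc d) → Euc d
  radius : ℕ → Set (Euc d) → ℝ
  borel : ∀ k : ℕ, ∀ Q ∈ cubes k, MeasurableSet Q
  cover : ∀ k : ℕ, ⋃₀ cubes k = measSupport μ
  disj : ∀ k : ℕ, (cubes k).PairwiseDisjoint id
  nested : ∀ k l : ℕ, k < l → ∀ Q ∈ cubes l, ∀ R ∈ cubes k, Q ∩ R = ∅ ∨ Q ⊆ R
  center_mem : ∀ k : ℕ, ∀ Q ∈ cubes k, center k Q ∈ measSupport μ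
  radius_lb : ∀ k : ℕ, ∀ Q ∈ cubes k, A₀ ^ (-(k : ℤ)) ≤ radius k Q
  radius_ub : ∀ k : ℕ, ∀ Q ∈ cubes k, radius k Q ≤ C₀ * A₀ ^ (-(k : ℤ))
  ball_subset : ∀ k : ℕ, ∀ Q ∈ cubes k, measSupport μ ∩ ball (center k Q) (radius k Q) ⊆ Q
  subset_ball : ∀ k : ℕ, ∀ Q ∈ cubes k, Q ⊆ measSupport μ ∩ ball (center k Q) (28 * radius k Q)
  balls_disjoint : ∀ k : ℕ, ∀ Q ∈ cubes k, ∀ R ∈ cubes k, Q ≠ R →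
    Disjoint (ball (center k Q) (5 * radius k Q)) (ball (center k R) (5 * radius k R))
  small_boundaries : ∃ C : ℝ, 0 < C ∧ ∀ k : ℕ, ∀ Q ∈ cubes k, ∀ l : ℕ,
    μ ({x ∈ measSupport μ \ Q | Metric.infDist x Q < A₀ ^ (-(k : ℤ) - (l : ℤ))} ∪
        {x ∈ Q | Metric.infDist x (measSupport μ \ Q) < A₀ ^ (-(k : ℤ) - (l : ℤ))}) ≤
      ENNReal.ofReal ((C⁻¹ * C₀ ^ (-(3 * (d : ℤ) + 1)) * A₀) ^ (-(l : ℤ))) *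
        μ (ball (center k Q) (90 * radius k Q))
  non_doubling_radius : ∀ k : ℕ, ∀ Q ∈ cubes k,
    ¬ μ (ball (center k Q) (100 * radius k Q)) ≤
        ENNReal.ofReal C₀ * μ (ball (center k Q) (radius k Q)) →
      radius k Q = A₀ ^ (-(k : ℤ))
  non_doubling_decay : ∀ k : ℕ, ∀ Q ∈ cubes k,
    ¬ μ (ball (center k Q) (100 * radius k Q)) ≤
        ENNReal.ofReal C₀ * μ (ball (center k Q) (radius k Q)) →
      ∀ l : ℕ, 1 ≤ l → (100 : ℝ) ^ l ≤ C₀ →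
        μ (ball (center k Q) (100 * radius k Q)) ≤
          ENNReal.ofReal (C₀ ^ (-(l : ℤ))) *
            μ (ball (center k Q) ((100 : ℝ) ^ (l + 1) * radius k Q))

/-- The dilated cube `λQ`: the union of the same-generation cubes `P` with
`dist(x_Q, P) ≤ λ ℓ(Q)`. -/
def DMLattice.dilate {d : ℕ} {μ : Measure (Euc d)} {C₀ A₀ : ℝ} (L : DMLattice d μ C₀ A₀)
    (lam : ℝ) (k : ℕ) (Q : Set (Euc d)) : Set (Euc d) :=
  ⋃₀ {P ∈ L.cubes k | Metric.infDist (L.center k Q) P ≤ lam * sideLen C₀ A₀ k}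

/-- The Poisson-type coefficient `P(Q) = Σ_{R ∈ D_μ, R ⊇ Q} (ℓ(Q)/ℓ(R)^{n+1}) μ(2B_R)` for a
generation-`k` cube `Q` (the sum running over the ancestors of `Q`). -/
def coefP {d : ℕ} {μ : Measure (Euc d)} {C₀ A₀ : ℝ} (L : DMLattice d μ C₀ A₀)
    (n k : ℕ) (Q : Set (Euc d)) : ℝ≥0∞ :=
  ∑' (j : ℕ), ∑' (R : L.cubes j),
    if j ≤ k ∧ Q ⊆ (R : Set (Euc d)) then
      ENNReal.ofReal (sideLen C₀ A₀ k / sideLen C₀ A₀ j ^ (n + 1)) *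
        μ (ball (L.center j (R : Set (Euc d))) (56 * L.radius j (R : Set (Euc d))))
    else 0

/-- A generation-`k` cube `Q` is `P`-doubling if `P(Q) ≤ 4 A₀ⁿ μ(2B_Q)/ℓ(Q)ⁿ`. -/
def PDoubling {d : ℕ} {μ : Measure (Euc d)} {C₀ A₀ : ℝ} (L : DMLattice d μ C₀ A₀)
    (n k : ℕ) (Q : Set (Euc d)) : Prop :=
  coefP L n k Q ≤ ENNReal.ofReal (4 * A₀ ^ n) *
    (μ (ball (L.center k Q) (56 * L.radius k Q)) / ENNReal.ofReal (sideLen C₀ A₀ k ^ n))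

theorem four_mul_rpow_pow_lt {C Λ : ℝ} {m N : ℕ} (hC : 4 < C) (hN : Λ * m + 1 ≤ N) :
    4 * (C ^ Λ) ^ m < C ^ N := by
  have hC0 : 0 < C := by linarith
  calc 4 * (C ^ Λ) ^ m = 4 * C ^ (Λ * m) := by rw [Real.rpow_mul_natCast hC0.le]
    _ < C * C ^ (Λ * m) := by gcongr
    _ = C ^ (Λ * m + 1) := by rw [Real.rpow_add_one hC0.ne']; ring
    _ ≤ C ^ (N : ℝ) := Real.rpow_le_rpow_of_exponent_le (by linarith) hN
    _ = C ^ N := Real.rpow_natCast C N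

theorem zpow_neg_natCast_eq_mul_succ {A : ℝ} (hA : A ≠ 0) (j : ℕ) :
    A ^ (-(j : ℤ)) = A * A ^ (-((j + 1 : ℕ) : ℤ)) := by
  rw [← zpow_one_add₀ hA]
  congr 1
  push_cast
  ring

theorem sideLen_eq_pow_mul_sideLen {C₀ A₀ : ℝ} (hA : A₀ ≠ 0) (j t : ℕ) :
    sideLen C₀ A₀ j = A₀ ^ t * sideLen C₀ A₀ (j + t) := by
  have h : A₀ ^ (-(j : ℤ)) = A₀ ^ t * A₀ ^ (-((j + t : ℕ) : ℤ)) := by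
    rw [← zpow_natCast A₀ t, ← zpow_add₀ hA]
    congr 1
    push_cast
    ring
  rw [sideLen, sideLen, h]
  ring

namespace DMLattice

theorem A₀_pos {d : ℕ} {μ : Measure (Euc d)} {C₀ A₀ : ℝ} (L : DMLattice d μ C₀ A₀) : 0 < A₀ := by
  have := L.hC₀
  have := L.hA₀
  linarith

variable {d : ℕ} {μ : Measure (Euc d)} {C₀ A₀ : ℝ} (L : DMLattice d μ C₀ A₀)

theorem radius_pos {k : ℕ} {Q : Set (Euc d)} (hQ : Q ∈ L.cubes k) : 0 < L.radius k Q :=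
  (zpow_pos L.A₀_pos _).trans_le (L.radius_lb k Q hQ)

theorem center_mem_cube {k : ℕ} {Q : Set (Euc d)} (hQ : Q ∈ L.cubes k) : L.center k Q ∈ Q :=
  L.ball_subset k Q hQ ⟨L.center_mem k Q hQ, mem_ball_self (L.radius_pos hQ)⟩

theorem dist_center_lt {k : ℕ} {Q : Set (Euc d)} (hQ : Q ∈ L.cubes k) {x : Euc d} (hx : x ∈ Q) :
    dist x (L.center k Q) < 28 * L.radius k Q :=
  mem_ball.1 (L.subset_ball k Q hQ hx).2

theorem radius_succ_le {j : ℕ} {R S : Set (Euc d)} (hR : R ∈ L.cubes (j + 1))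
    (hS : S ∈ L.cubes j) : 5000 * L.radius (j + 1) R ≤ L.radius j S := by
  have hpos : 0 < A₀ ^ (-((j + 1 : ℕ) : ℤ)) := zpow_pos L.A₀_pos _
  have hub := L.radius_ub _ R hR
  have hlb := L.radius_lb j S hS
  rw [zpow_neg_natCast_eq_mul_succ L.A₀_pos.ne'] at hlb
  nlinarith [mul_lt_mul_of_pos_right L.hA₀ hpos]

theorem exists_ancestor {j k : ℕ} (hjk : j < k) {Q : Set (Euc d)} (hQ : Q ∈ L.cubes k) :
    ∃ S ∈ L.cubes j, Q ⊆ S := by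
  have hx : L.center k Q ∈ ⋃₀ L.cubes j := L.cover j ▸ L.center_mem k Q hQ
  obtain ⟨S, hS, hxS⟩ := hx
  refine ⟨S, hS, (L.nested j k hjk Q hQ S hS).resolve_left fun h => ?_⟩
  exact (Set.ext_iff.1 h _).1 ⟨L.center_mem_cube hQ, hxS⟩

theorem le_coefP (n : ℕ) {j k : ℕ} (hjk : j ≤ k) {Q S : Set (Euc d)} (hS : S ∈ L.cubes j)
    (hQS : Q ⊆ S) :
    ENNReal.ofReal (sideLen C₀ A₀ k / sideLen C₀ A₀ j ^ (n + 1)) *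
      μ (ball (L.center j S) (56 * L.radius j S)) ≤ coefP L n k Q := by
  unfold coefP
  refine le_trans ?_ (ENNReal.le_tsum j)
  refine le_trans ?_ (ENNReal.le_tsum (⟨S, hS⟩ : L.cubes j))
  rw [if_pos ⟨hjk, hQS⟩]

/-- The measure of the doubled ball of an ancestor of a `P`-doubling cube is controlled by that of
the cube itself. -/
theorem measureReal_ancestor_le [IsLocallyFiniteMeasure μ] {n j t : ℕ} {Q S : Set (Euc d)}
    (hPD : PDoubling L n (j + t) Q) (hS : S ∈ L.cubes j) (hQS : Q ⊆ S) :
    μ.real (ball (L.center j S) (56 * L.radius j S)) ≤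
      4 * A₀ ^ (n + t * (n + 1)) *
        μ.real (ball (L.center (j + t) Q) (56 * L.radius (j + t) Q)) := by
  have hC : 0 < C₀ := by linarith [L.hC₀]
  have hA := L.A₀_pos
  have hs : 0 < sideLen C₀ A₀ (j + t) := by
    have := zpow_pos hA (-((j + t : ℕ) : ℤ))
    unfold sideLen
    positivity
  have h := (L.le_coefP n (Nat.le_add_right j t) hS hQS).trans hPD
  rw [sideLen_eq_pow_mul_sideLen hA.ne' j t] at h
  generalize sideLen C₀ A₀ (j + t) = s at h hs
  have hfin : ENNReal.ofReal (4 * A₀ ^ n) *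
      (μ (ball (L.center (j + t) Q) (56 * L.radius (j + t) Q)) / ENNReal.ofReal (s ^ n)) ≠ ⊤ :=
    ENNReal.mul_ne_top ENNReal.ofReal_ne_top
      (ENNReal.div_ne_top measure_ball_lt_top.ne (ENNReal.ofReal_pos.2 (by positivity)).ne')
  have h' := ENNReal.toReal_mono hfin h
  rw [ENNReal.toReal_mul, ENNReal.toReal_mul, ENNReal.toReal_div,
    ENNReal.toReal_ofReal (by positivity), ENNReal.toReal_ofReal (by positivity),
    ENNReal.toReal_ofReal (by positivity)] at h'
  change _ * μ.real _ ≤ _ * (μ.real _ / _) at h'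
  generalize μ.real (ball (L.center j S) (56 * L.radius j S)) = M at h' ⊢
  generalize μ.real (ball (L.center (j + t) Q) (56 * L.radius (j + t) Q)) = m at h' ⊢
  have key := mul_le_mul_of_nonneg_left h'
    (show 0 ≤ A₀ ^ (t * (n + 1)) * s ^ n by positivity)
  calc M = A₀ ^ (t * (n + 1)) * s ^ n * (s / (A₀ ^ t * s) ^ (n + 1) * M) := by
        rw [mul_pow, ← pow_mul, pow_succ s n]
        field_simp
    _ ≤ _ := key
    _ = _ := by
        rw [pow_add]
        field_simp

/-- A cube `R` of generation `j + 1` whose ball `100B(R)` contains `2B_Q`, for a `P`-doubling cube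
`Q` of generation `j + 1` or `j + 2`, is doubling. -/
theorem doubling_of_ball_subset [IsLocallyFiniteMeasure μ] {n N j t : ℕ} (hN : 1 ≤ N)
    (hNC : (100 : ℝ) ^ N ≤ C₀) (hNA : 4 * A₀ ^ (3 * n + 2) < C₀ ^ N) (ht : 1 ≤ t) (ht2 : t ≤ 2)
    {Q R : Set (Euc d)} (hQ : Q ∈ L.cubes (j + t)) (hPD : PDoubling L n (j + t) Q)
    (hR : R ∈ L.cubes (j + 1))
    (hsub : ball (L.center (j + t) Q) (56 * L.radius (j + t) Q) ⊆
      ball (L.center (j + 1) R) (100 * L.radius (j + 1) R)) :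
    μ (ball (L.center (j + 1) R) (100 * L.radius (j + 1) R)) ≤
      ENNReal.ofReal C₀ * μ (ball (L.center (j + 1) R) (L.radius (j + 1) R)) := by
  by_contra hnd
  obtain ⟨S, hS, hQS⟩ := L.exists_ancestor (show j < j + t by omega) hQ
  have hC : 0 < C₀ := by linarith [L.hC₀]
  have hA := L.A₀_pos
  have hrQ := L.radius_pos hQ
  have hQpos : 0 < μ.real (ball (L.center (j + t) Q) (56 * L.radius (j + t) Q)) :=
    ENNReal.toReal_pos (L.center_mem _ Q hQ _ (by positivity)).ne' measure_ball_lt_top.ne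
  have hball : ball (L.center (j + 1) R) ((100 : ℝ) ^ (N + 1) * L.radius (j + 1) R) ⊆
      ball (L.center j S) (56 * L.radius j S) := by
    apply ball_subset_ball'
    have h1 := L.dist_center_lt hS (hQS (L.center_mem_cube hQ))
    have h2 := mem_ball'.1 (hsub (mem_ball_self (by positivity)))
    have h3 := dist_triangle (L.center (j + 1) R) (L.center (j + t) Q) (L.center j S)
    have h4 := L.radius_succ_le hR hS
    have hpos : 0 < A₀ ^ (-((j + 1 : ℕ) : ℤ)) := zpow_pos hA _
    have h5 : (100 : ℝ) ^ (N + 1) * L.radius (j + 1) R ≤ 100 / 5000 * L.radius j S := by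
      have hlb := L.radius_lb j S hS
      rw [zpow_neg_natCast_eq_mul_succ hA.ne'] at hlb
      rw [L.non_doubling_radius _ R hR hnd, pow_succ]
      nlinarith [mul_lt_mul_of_pos_right L.hA₀ hpos, mul_le_mul_of_nonneg_right hNC hpos.le]
    linarith [L.radius_pos hS]
  have hdecay := ((measure_mono hsub).trans (L.non_doubling_decay _ R hR hnd N hN hNC)).trans
    (mul_le_mul_right (measure_mono hball) _)
  have hreal := ENNReal.toReal_mono
    (ENNReal.mul_ne_top ENNReal.ofReal_ne_top measure_ball_lt_top.ne) hdecay
  rw [ENNReal.toReal_mul, ENNReal.toReal_ofReal (by positivity), zpow_neg, zpow_natCast] at hreal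
  change μ.real _ ≤ _ * μ.real _ at hreal
  have hanc := L.measureReal_ancestor_le hPD hS hQS
  have hpow : A₀ ^ (n + t * (n + 1)) ≤ A₀ ^ (3 * n + 2) :=
    pow_le_pow_right₀ (by linarith [L.hA₀, L.hC₀]) (by nlinarith)
  generalize μ.real (ball (L.center j S) (56 * L.radius j S)) = M at hreal hanc
  generalize μ.real (ball (L.center (j + t) Q) (56 * L.radius (j + t) Q)) = m
    at hreal hanc hQpos
  have hM : C₀ ^ N * m ≤ M := (le_inv_mul_iff₀ (by positivity)).1 hreal
  have : 4 * A₀ ^ (n + t * (n + 1)) * m < C₀ ^ N * m := by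
    gcongr
    linarith
  linarith

theorem ball_subset_of_inter_dilate {k : ℕ} {Q R : Set (Euc d)} (hR : R ∈ L.cubes k)
    (hQ : Q ∈ L.cubes (k + 1)) (h : (R ∩ L.dilate 2 (k + 1) Q).Nonempty) :
    ball (L.center (k + 1) Q) (56 * L.radius (k + 1) Q) ⊆
      ball (L.center k R) (100 * L.radius k R) := by
  obtain ⟨y, hyR, P, ⟨hP, hPd⟩, hyP⟩ := h
  have hpos : 0 < A₀ ^ (-((k + 1 : ℕ) : ℤ)) := zpow_pos L.A₀_pos _
  have hCpos : 0 < C₀ * A₀ ^ (-((k + 1 : ℕ) : ℤ)) := mul_pos (by linarith [L.hC₀]) hpos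
  obtain ⟨z, hzP, hz⟩ := (infDist_lt_iff ⟨y, hyP⟩).1
    (hPd.trans_lt (lt_add_of_pos_right _ hCpos))
  have h1 := L.dist_center_lt hP hzP
  have h2 := L.dist_center_lt hP hyP
  have h3 := L.dist_center_lt hR hyR
  have h4 := dist_triangle (L.center (k + 1) Q) z (L.center k R)
  have h5 := dist_triangle z y (L.center k R)
  have h6 := dist_triangle_right z y (L.center (k + 1) P)
  have hPr := L.radius_ub _ P hP
  have hQr := L.radius_ub _ Q hQ
  have hRr := L.radius_lb k R hR
  rw [zpow_neg_natCast_eq_mul_succ L.A₀_pos.ne'] at hRr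
  have hmul := mul_lt_mul_of_pos_right L.hA₀ hpos
  unfold sideLen at hz
  apply ball_subset_ball'
  linarith

end DMLattice

/-- For every `Λ ≥ 1` there is `c(d,Λ)` such that whenever `C₀ ≥ c(d,Λ)` and
`A₀ = C₀^Λ`, for every David–Mattila lattice with `D_{μ,0} = {supp μ}` every `P`-doubling cube
`Q` of generation `k ≥ 3` satisfies `μ(100B(Q)) ≤ C₀ μ(B(Q))`, and moreover every cube `R` with
`R ∩ 2Q ≠ ∅` and `ℓ(R) = A₀ ℓ(Q)` satisfies `μ(100B(R)) ≤ C₀ μ(B(R))`. -/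
theorem pdoubling_implies_doubling (d n : ℕ) (hn : 1 ≤ n) (hnd : n ≤ d) (Λ : ℝ) (hΛ : 1 ≤ Λ) :
    ∃ c : ℝ, 0 < c ∧ ∀ C₀ A₀ : ℝ, c ≤ C₀ → A₀ = C₀ ^ Λ →
      ∀ (μ : Measure (Euc d)), IsLocallyFiniteMeasure μ → IsCompact (measSupport μ) →
        ∀ L : DMLattice d μ C₀ A₀, L.cubes 0 = {measSupport μ} →
          ∀ k : ℕ, 3 ≤ k → ∀ Q ∈ L.cubes k, PDoubling L n k Q →
            (μ (ball (L.center k Q) (100 * L.radius k Q)) ≤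
                ENNReal.ofReal C₀ * μ (ball (L.center k Q) (L.radius k Q))) ∧
            ∀ R ∈ L.cubes (k - 1), (R ∩ L.dilate 2 k Q).Nonempty →
              μ (ball (L.center (k - 1) R) (100 * L.radius (k - 1) R)) ≤
                ENNReal.ofReal C₀ * μ (ball (L.center (k - 1) R) (L.radius (k - 1) R)) := by
  obtain ⟨N, hN⟩ := exists_nat_ge (Λ * (3 * n + 2 : ℕ) + 1)
  have hN1 : 1 ≤ N := by
    have : (1 : ℝ) ≤ N := by
      have : 0 ≤ Λ * (3 * n + 2 : ℕ) := by positivity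
      linarith
    exact_mod_cast this
  refine ⟨100 ^ N, by positivity, ?_⟩
  rintro C₀ A₀ hC rfl μ hμ - L - k hk Q hQ hPD
  have h100 : (100 : ℝ) ≤ 100 ^ N := le_self_pow₀ (by norm_num) (by omega)
  have hA := four_mul_rpow_pow_lt (show 4 < C₀ by linarith) hN
  obtain ⟨j, rfl⟩ := Nat.exists_eq_add_of_le' hk
  constructor
  · exact L.doubling_of_ball_subset (j := j + 2) (t := 1) hN1 hC hA le_rfl one_le_two hQ hPD hQ
      (ball_subset_ball (by linarith [L.radius_pos hQ]))
  · intro R hR hne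
    exact L.doubling_of_ball_subset (j := j + 1) (t := 2) hN1 hC hA one_le_two le_rfl hQ hPD hR
      (L.ball_subset_of_inter_dilate hR hQ hne)
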